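/- Let P be a partial order and K ⊆ P a lower set. Let I be the three-element partial order {0⁻, 0⁺, 1} whose only strict order relations are 0⁻ < 1 and 0⁺ < 1, and let C := K ⊕ (I × {x : P // x ∉ K}) carry the partial order: inl z ≤ inl z' iff z ≤ z'; inl z ≤ inr (j, y) iff z ≤ y; inr (i, x) ≤ inl z' never; inr (i, x) ≤ inr (j, y) iff i ≤ j and x ≤ y. Define the projection τ : C → P by τ (inl z) = z and τ (inr (i, x)) = x. Then τ is a monotone surjection and a Grothendieck fibration of posets: for every a ∈ C and every y ∈ P with y ≤ τ a, there exists b ∈ C with b ≤ a and τ b = y which is a cartesian lift, i.e., for every c ∈ C with c ≤ a and τ c ≤ y one has c ≤ b. -/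

import Mathlib

/-- The face poset `I` of the oriented 1-ball: elements `0⁻`, `0⁺`, `1`,
with only strict relations `0⁻ < 1` and `0⁺ < 1`. -/
inductive Ar : Type
  | minus : Ar
  | plus : Ar
  | top : Ar
deriving DecidableEq

instance : PartialOrder Ar where
  le a b := a = b ∨ b = Ar.top
  le_refl a := Or.inl rfl
  le_trans a b c hab hbc := by
    rcases hab with rfl | rfl
    · exact hbc
    · rcases hbc with rfl | rfl <;> exact Or.inr rfl
  le_antisymm a b hab hba := by
    rcases hab with rfl | rfl
    · rfl
    · rcases hba with rfl | rfl <;> rfl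

/-- The underlying type of the partial cylinder `I ×_K P`:
elements of `K`, plus pairs `(i, x)` with `i ∈ I` and `x ∉ K`. -/
abbrev Cyl (P : Type*) (K : Set P) : Type _ :=
  ↥K ⊕ (Ar × {x : P // x ∉ K})

/-- The order relation on the partial cylinder. -/
def cylLe {P : Type*} [PartialOrder P] (K : Set P) :
    Cyl P K → Cyl P K → Prop
  | Sum.inl z, Sum.inl z' => (z : P) ≤ (z' : P)
  | Sum.inl z, Sum.inr jy => (z : P) ≤ (jy.2 : P)
  | Sum.inr _, Sum.inl _ => False
  | Sum.inr ix, Sum.inr jy => ix.1 ≤ jy.1 ∧ (ix.2 : P) ≤ (jy.2 : P)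

/-- The projection `τ_K : I ×_K P → P` of the partial cylinder. -/
def cylTau {P : Type*} (K : Set P) : Cyl P K → P
  | Sum.inl z => (z : P)
  | Sum.inr ix => (ix.2 : P)

/-- The projection `τ_K : I ×_K P → P` is a monotone surjection and a Grothendieck
fibration of posets: every `y ≤ τ_K a` admits a cartesian lift `b ≤ a` with
`τ_K b = y`, i.e. every `c ≤ a` with `τ_K c ≤ y` satisfies `c ≤ b`. -/
theorem cylTau_cartesian {P : Type*} [PartialOrder P] (K : Set P)
    (hK : IsLowerSet K) :
    (∀ a b : Cyl P K, cylLe K a b → cylTau K a ≤ cylTau K b) ∧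
    Function.Surjective (cylTau K) ∧
    (∀ a : Cyl P K, ∀ y : P, y ≤ cylTau K a →
      ∃ b : Cyl P K, cylLe K b a ∧ cylTau K b = y ∧
        ∀ c : Cyl P K, cylLe K c a → cylTau K c ≤ y → cylLe K c b) := by
  refine ⟨?_, fun x => ?_, ?_⟩
  · rintro (z | ⟨i, x⟩) (z' | ⟨j, y⟩) h
    · exact h
    · exact h
    · exact h.elim
    · exact h.2
  · by_cases hx : x ∈ K
    · exact ⟨Sum.inl ⟨x, hx⟩, rfl⟩
    · exact ⟨Sum.inr (Ar.top, ⟨x, hx⟩), rfl⟩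
  · rintro (z | ⟨i, x⟩) y hy
    · refine ⟨Sum.inl ⟨y, hK hy z.2⟩, hy, rfl, ?_⟩
      rintro (w | _) hc hcy
      · exact hcy
      · exact hc.elim
    · by_cases hyK : y ∈ K
      · refine ⟨Sum.inl ⟨y, hyK⟩, hy, rfl, ?_⟩
        rintro (w | ⟨_, w⟩) _ hcy
        · exact hcy
        · exact w.2 (hK hcy hyK)
      · refine ⟨Sum.inr (i, ⟨y, hyK⟩), ⟨le_rfl, hy⟩, rfl, ?_⟩
        rintro (w | _) hc hcy
        · exact hcy
        · exact ⟨hc.1, hcy⟩
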